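/- The Hermitian adjoint of the G map: let N ≥ 2 be an integer, let Γ be a real matrix on pair indices with the fermionic symmetries, and let A : Matrix (ι × ι) (ι × ι) ℝ be arbitrary. Define G(Γ)_{(α,β),(γ,δ)} := δ_{βδ}·ρ_{αγ} − Γ_{(α,δ),(γ,β)} with ρ_{αγ} := (N−1)⁻¹·Σ_β Γ_{(α,β),(γ,β)}, and define G†(A)_{(α,β),(γ,δ)} := (N−1)⁻¹·[ δ_{βδ}·Ā_{αγ} − δ_{αδ}·Ā_{βγ} − δ_{βγ}·Ā_{αδ} + δ_{αγ}·Ā_{βδ} ] − A_{(α,δ),(γ,β)} + A_{(β,δ),(γ,α)} + A_{(α,γ),(δ,β)} − A_{(β,γ),(δ,α)}, where Ā_{αγ} := Σ_λ A_{(α,λ),(γ,λ)}. Then ⟨G(Γ), A⟩_ph = ⟨G†(A), Γ⟩_tp. -/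

import Mathlib

open Matrix

/-- The fermionic symmetries of a matrix on pair indices. -/
def FermionicSym {ι : Type*} (Γ : Matrix (ι × ι) (ι × ι) ℝ) : Prop :=
  ∀ α β γ δ : ι,
    Γ (α, β) (γ, δ) = -Γ (β, α) (γ, δ) ∧
    Γ (α, β) (γ, δ) = -Γ (α, β) (δ, γ) ∧
    Γ (α, β) (γ, δ) = Γ (γ, δ) (α, β)

/-- The partial trace `Ā_{αγ} = Σ_λ A_{(α,λ),(γ,λ)}`. -/
def pTr {ι : Type*} [Fintype ι] (A : Matrix (ι × ι) (ι × ι) ℝ) : Matrix ι ι ℝ :=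
  fun α γ => ∑ l : ι, A (α, l) (γ, l)

/-- The one-particle density matrix `ρ_{αγ} = (N−1)⁻¹ · Σ_β Γ_{(α,β),(γ,β)}`. -/
noncomputable def rho1 {ι : Type*} [Fintype ι] (N : ℕ)
    (Γ : Matrix (ι × ι) (ι × ι) ℝ) : Matrix ι ι ℝ :=
  fun α γ => ((N : ℝ) - 1)⁻¹ * ∑ β : ι, Γ (α, β) (γ, β)

/-- The particle-hole map `G(Γ)_{(α,β),(γ,δ)} = δ_{βδ}·ρ_{αγ} − Γ_{(α,δ),(γ,β)}`. -/
noncomputable def Gmap {ι : Type*} [Fintype ι] [DecidableEq ι] (N : ℕ)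
    (Γ : Matrix (ι × ι) (ι × ι) ℝ) : Matrix (ι × ι) (ι × ι) ℝ :=
  fun p q => (if p.2 = q.2 then rho1 N Γ p.1 q.1 else 0) - Γ (p.1, q.2) (q.1, p.2)

/-- The Hermitian adjoint of the particle-hole map:
`G†(A)_{(α,β),(γ,δ)} = (N−1)⁻¹·[δ_{βδ}Ā_{αγ} − δ_{αδ}Ā_{βγ} − δ_{βγ}Ā_{αδ} + δ_{αγ}Ā_{βδ}]
  − A_{(α,δ),(γ,β)} + A_{(β,δ),(γ,α)} + A_{(α,γ),(δ,β)} − A_{(β,γ),(δ,α)}`. -/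
noncomputable def Gdag {ι : Type*} [Fintype ι] [DecidableEq ι] (N : ℕ)
    (A : Matrix (ι × ι) (ι × ι) ℝ) : Matrix (ι × ι) (ι × ι) ℝ :=
  fun p q =>
    ((N : ℝ) - 1)⁻¹ *
      ((if p.2 = q.2 then pTr A p.1 q.1 else 0)
        - (if p.1 = q.2 then pTr A p.2 q.1 else 0)
        - (if p.2 = q.1 then pTr A p.1 q.2 else 0)
        + (if p.1 = q.1 then pTr A p.2 q.2 else 0))
    - A (p.1, q.2) (q.1, p.2) + A (p.2, q.2) (q.1, p.1)
    + A (p.1, q.1) (q.2, p.2) - A (p.2, q.1) (q.2, p.1)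

/-- The two-particle inner product. -/
noncomputable def tpInner {ι : Type*} [Fintype ι]
    (A B : Matrix (ι × ι) (ι × ι) ℝ) : ℝ :=
  (1 / 4 : ℝ) * ∑ α : ι, ∑ β : ι, ∑ γ : ι, ∑ δ : ι, A (α, β) (γ, δ) * B (α, β) (γ, δ)

/-- The particle-hole inner product. -/
noncomputable def phInner {ι : Type*} [Fintype ι]
    (A B : Matrix (ι × ι) (ι × ι) ℝ) : ℝ :=
  ∑ α : ι, ∑ β : ι, ∑ γ : ι, ∑ δ : ι, A (α, β) (γ, δ) * B (α, β) (γ, δ)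

/-- `Gdag` is the antisymmetrization of `Gmap` in both index pairs. -/
lemma Gdag_apply_eq_antisymm {ι : Type*} [Fintype ι] [DecidableEq ι] (N : ℕ)
    (A : Matrix (ι × ι) (ι × ι) ℝ) (α β γ δ : ι) :
    Gdag N A (α, β) (γ, δ) =
      Gmap N A (α, β) (γ, δ) - Gmap N A (β, α) (γ, δ)
        - Gmap N A (α, β) (δ, γ) + Gmap N A (β, α) (δ, γ) := by
  have hρ (a b : ι) (P : Prop) [Decidable P] :
      (if P then rho1 N A a b else 0) =
        ((N : ℝ) - 1)⁻¹ * (if P then pTr A a b else 0) := by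
    split_ifs <;> simp [rho1, pTr]
  simp only [Gdag, Gmap, hρ]
  ring

/-- Pairing `Gmap N Γ` with `A` is a trace term minus an exchange term. -/
lemma phInner_Gmap {ι : Type*} [Fintype ι] [DecidableEq ι] (N : ℕ)
    (Γ A : Matrix (ι × ι) (ι × ι) ℝ) :
    phInner (Gmap N Γ) A =
      ((N : ℝ) - 1)⁻¹ * (∑ α, ∑ γ, pTr Γ α γ * pTr A α γ)
        - ∑ α, ∑ β, ∑ γ, ∑ δ, Γ (α, δ) (γ, β) * A (α, β) (γ, δ) := by
  simp only [phInner, Gmap, sub_mul, Finset.sum_sub_distrib, ite_mul, zero_mul,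
    Finset.sum_ite_eq, Finset.mem_univ, if_true]
  congr 1
  rw [Finset.mul_sum]
  refine Finset.sum_congr rfl fun α _ => ?_
  rw [Finset.sum_comm, Finset.mul_sum]
  refine Finset.sum_congr rfl fun γ _ => ?_
  rw [← Finset.mul_sum]
  simp only [rho1, pTr, mul_assoc]

/-- `Gmap` is self-adjoint for the particle-hole inner product. -/
lemma phInner_Gmap_comm {ι : Type*} [Fintype ι] [DecidableEq ι] (N : ℕ)
    (Γ A : Matrix (ι × ι) (ι × ι) ℝ) :
    phInner (Gmap N Γ) A = phInner (Gmap N A) Γ := by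
  rw [phInner_Gmap, phInner_Gmap]
  congr 1
  · simp only [mul_comm (pTr Γ _ _)]
  · refine Finset.sum_congr rfl fun α _ => ?_
    simp only [mul_comm (Γ _ _)]
    rw [Finset.sum_comm_cycle]
    exact Finset.sum_congr rfl fun δ _ => Finset.sum_comm

/-- Swapping the first pair of indices of `B` negates its pairing with `Γ`. -/
lemma FermionicSym.sum_swap_left {ι : Type*} [Fintype ι]
    {Γ : Matrix (ι × ι) (ι × ι) ℝ} (hsym : FermionicSym Γ)
    (B : Matrix (ι × ι) (ι × ι) ℝ) :
    ∑ α, ∑ β, ∑ γ, ∑ δ, B (β, α) (γ, δ) * Γ (α, β) (γ, δ) = -phInner B Γ := by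
  rw [Finset.sum_comm]
  simp only [phInner, ← Finset.sum_neg_distrib, ← mul_neg, ← (hsym _ _ _ _).1]

/-- Swapping the second pair of indices of `B` negates its pairing with `Γ`. -/
lemma FermionicSym.sum_swap_right {ι : Type*} [Fintype ι]
    {Γ : Matrix (ι × ι) (ι × ι) ℝ} (hsym : FermionicSym Γ)
    (B : Matrix (ι × ι) (ι × ι) ℝ) :
    ∑ α, ∑ β, ∑ γ, ∑ δ, B (α, β) (δ, γ) * Γ (α, β) (γ, δ) = -phInner B Γ := by
  simp only [phInner, ← Finset.sum_neg_distrib, ← mul_neg, ← (hsym _ _ _ _).2.1]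
  exact Finset.sum_congr rfl fun α _ => Finset.sum_congr rfl fun β _ => Finset.sum_comm

/-- The Hermitian adjoint property of the `G` map:
`⟨G(Γ), A⟩_ph = ⟨G†(A), Γ⟩_tp` for every `Γ` with the fermionic symmetries and
every matrix `A` on pair indices. -/
theorem Gmap_hermitian_adjoint
    {ι : Type*} [Fintype ι] [DecidableEq ι] (N : ℕ) (hN : 2 ≤ N)
    (Γ : Matrix (ι × ι) (ι × ι) ℝ) (hsym : FermionicSym Γ)
    (A : Matrix (ι × ι) (ι × ι) ℝ) :
    phInner (Gmap N Γ) A = tpInner (Gdag N A) Γ := by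
  have hswap : ∑ α, ∑ β, ∑ γ, ∑ δ, Gmap N A (β, α) (δ, γ) * Γ (α, β) (γ, δ) =
      phInner (Gmap N A) Γ := by
    rw [← neg_neg (phInner _ _), ← hsym.sum_swap_right]
    exact hsym.sum_swap_left fun p q => Gmap N A p (q.2, q.1)
  rw [phInner_Gmap_comm]
  simp only [tpInner, Gdag_apply_eq_antisymm, sub_mul, add_mul, Finset.sum_add_distrib,
    Finset.sum_sub_distrib]
  rw [hsym.sum_swap_left, hsym.sum_swap_right, hswap]
  simp only [phInner]
  ring
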